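/- Suppose f_{a₀,b₀} has an attracting periodic point x₀ of exact period p. Then there exist an open neighborhood U of (a₀,b₀) in ℝ/ℤ × [0,1] and a continuous map X : U → ℝ/ℤ with X(a₀,b₀) = x₀ such that for every (a,b) ∈ U, X(a,b) is an attracting periodic point of f_{a,b} of exact period p. -/

import Mathlib

open Set Filter Topology

noncomputable section

/-- Representative of a point of the circle in `[0,1)`. -/
noncomputable def rep (z : UnitAddCircle) : ℝ := (AddCircle.equivIco 1 0 z).val

/-- The straight sine map on `[0,1)`. -/
noncomputable def Sfun (t : ℝ) : ℝ := if t ≤ 1/2 then 4*t - 1 else -4*t + 3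

/-- The piecewise linear perturbation of the doubling map. -/
noncomputable def plpdm (a : UnitAddCircle) (b : ℝ) (z : UnitAddCircle) : UnitAddCircle :=
  ((2 * rep z + (b/2) * Sfun (rep z) : ℝ) : UnitAddCircle) + a

/-- The doubling map. -/
def Dbl (z : UnitAddCircle) : UnitAddCircle := z + z

/-- `x` is an attracting periodic point of `f` of exact period `n`. -/
def IsAttractingPeriodicPt (f : UnitAddCircle → UnitAddCircle) (n : ℕ)
    (x : UnitAddCircle) : Prop :=
  0 < n ∧ f^[n] x = x ∧ (∀ m, 0 < m → m < n → f^[m] x ≠ x) ∧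
  ∃ U : Set UnitAddCircle, IsOpen U ∧ IsConnected U ∧ x ∈ U ∧ f^[n] '' U ⊆ U ∧
    ∀ y ∈ U, Tendsto (fun k => f^[n*k] y) atTop (nhds x)

/-- Forward orbit of `x` under `f`. -/
def orbitSet (f : UnitAddCircle → UnitAddCircle) (x : UnitAddCircle) : Set UnitAddCircle :=
  {y | ∃ i, f^[i] x = y}

/-- Basin of attraction of the set `O`. -/
def basin (f : UnitAddCircle → UnitAddCircle) (O : Set UnitAddCircle) : Set UnitAddCircle :=
  {y | Tendsto (fun k => Metric.infDist (f^[k] y) O) atTop (nhds 0)}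

/-- Immediate basin of attraction of the orbit `O`. -/
def immBasin (f : UnitAddCircle → UnitAddCircle) (O : Set UnitAddCircle) :
    Set UnitAddCircle :=
  ⋃ z ∈ O, connectedComponentIn (basin f O) z

/-- The hyperbolic set `H`. -/
def hypSet : Set (UnitAddCircle × ℝ) :=
  {q | q.2 ∈ Set.Ico (0:ℝ) 1 ∧ ∃ n x, IsAttractingPeriodicPt (plpdm q.1 q.2) n x}

/-- The lift `F_{a,b}` of `f_{a,b}`, normalized so that `F_{a,b}(0) ∈ [0,1)`. -/
noncomputable def liftF (a : UnitAddCircle) (b : ℝ) (x : ℝ) : ℝ :=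
  (2 * Int.fract x + rep a + (b/2) * Sfun (Int.fract x)
    + (if rep a - b/2 < 0 then 1 else 0)) + 2 * (⌊x⌋ : ℝ)

/-- `Φ_{a,b}`, the limit of `F_{a,b}^n(x)/2^n`. -/
noncomputable def Phi (a : UnitAddCircle) (b : ℝ) (x : ℝ) : ℝ :=
  limUnder atTop (fun n : ℕ => (liftF a b)^[n] x / 2 ^ n)

/-- The semiconjugacy `φ_{a,b}` induced by `Φ_{a,b}`. -/
noncomputable def phiMap (a : UnitAddCircle) (b : ℝ) (z : UnitAddCircle) : UnitAddCircle :=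
  ((Phi a b (rep z) : ℝ) : UnitAddCircle)

/-- The arc `I₊ = [0,1/2]` of the circle. -/
def Iplus : Set UnitAddCircle := (fun t : ℝ => (t : UnitAddCircle)) '' Set.Icc 0 (1/2)

/-- The arc `I₋ = [1/2,1]` of the circle. -/
def Iminus : Set UnitAddCircle := (fun t : ℝ => (t : UnitAddCircle)) '' Set.Icc (1/2) 1

/-- The orbit of `x` (of period `p`) avoids `0`, `1/2` and has slope itinerary `σ`,
where `σ j = true` encodes the symbol `−` and `σ j = false` encodes `+`. -/
def HasItinerary (f : UnitAddCircle → UnitAddCircle) (p : ℕ) (x : UnitAddCircle)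
    (σ : Fin p → Bool) : Prop :=
  (∀ j : Fin p, f^[(j : ℕ)] x ≠ (0 : UnitAddCircle) ∧
      f^[(j : ℕ)] x ≠ (((1:ℝ)/2 : ℝ) : UnitAddCircle)) ∧
  ∀ j : Fin p, (σ j = true → f^[(j : ℕ)] x ∈ Iminus) ∧ (σ j = false → f^[(j : ℕ)] x ∈ Iplus)

/-- The set `P_σ` of parameters whose attracting orbit has slope itinerary `σ`. -/
def paramSet (p : ℕ) (σ : Fin p → Bool) : Set (UnitAddCircle × ℝ) :=
  {q | q.2 ∈ Set.Ico (0:ℝ) 1 ∧ ∃ x, IsAttractingPeriodicPt (plpdm q.1 q.2) p x ∧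
       HasItinerary (plpdm q.1 q.2) p x σ}

/-- `S` is a tongue: its closure meets `ℝ/ℤ × {1}` in a nondegenerate interval. -/
def IsTongue (S : Set (UnitAddCircle × ℝ)) : Prop :=
  ∃ u v : ℝ, u < v ∧ ∀ t ∈ Set.Icc u v, (((t : ℝ) : UnitAddCircle), (1:ℝ)) ∈ closure S

end



theorem UnitAddCircle.norm_coe_le (x : ℝ) : ‖(x : UnitAddCircle)‖ ≤ |x| := by
  rw [UnitAddCircle.norm_eq]
  simpa using round_le x 0

theorem UnitAddCircle.norm_coe_eq_abs {x : ℝ} (hx : |x| ≤ 1 / 2) :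
    ‖(x : UnitAddCircle)‖ = |x| :=
  (AddCircle.norm_coe_eq_abs_iff 1 one_ne_zero).2 (by simpa using hx)

theorem UnitAddCircle.norm_coe_of_mem_Icc {x : ℝ} (h0 : 0 ≤ x) (h1 : x ≤ 1 / 2) :
    ‖(x : UnitAddCircle)‖ = x := by
  rw [norm_coe_eq_abs (by rwa [abs_of_nonneg h0]), abs_of_nonneg h0]

theorem UnitAddCircle.coe_sub_one (x : ℝ) : ((x - 1 : ℝ) : UnitAddCircle) = x := by
  rw [← AddCircle.coe_add_period (1 : ℝ) (x - 1), sub_add_cancel]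

theorem UnitAddCircle.norm_coe_of_half_le {x : ℝ} (h0 : 1 / 2 ≤ x) (h1 : x ≤ 1) :
    ‖(x : UnitAddCircle)‖ = 1 - x := by
  have h : |x - 1| = 1 - x := by rw [abs_of_nonpos (by linarith)]; ring
  rw [← coe_sub_one, norm_coe_eq_abs (by rw [h]; linarith), h]

theorem UnitAddCircle.exists_abs_eq_norm (z : UnitAddCircle) :
    ∃ u : ℝ, (u : UnitAddCircle) = z ∧ |u| = ‖z‖ := by
  induction z using QuotientAddGroup.induction_on with
  | H x =>
    refine ⟨x - round x, ?_, (UnitAddCircle.norm_eq).symm⟩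
    rw [AddCircle.coe_sub, sub_eq_self, AddCircle.coe_eq_zero_iff]
    exact ⟨round x, by simp⟩

theorem UnitAddCircle.coe_eq_coe_iff {x y : ℝ} :
    (x : UnitAddCircle) = y ↔ ∃ n : ℤ, x - y = n := by
  rw [← sub_eq_zero, ← AddCircle.coe_sub, AddCircle.coe_eq_zero_iff]
  simp [eq_comm]

theorem UnitAddCircle.isPreconnected_ball (z : UnitAddCircle) (r : ℝ) :
    IsPreconnected (Metric.ball z r) := by
  obtain ⟨x, rfl⟩ := QuotientAddGroup.mk_surjective z
  have h : Metric.ball (x : UnitAddCircle) r = (fun t : ℝ => (t : UnitAddCircle)) ''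
      Metric.ball x r := by
    ext w
    simp only [Metric.mem_ball, mem_image]
    constructor
    · intro hw
      obtain ⟨u, hu, hu'⟩ := exists_abs_eq_norm (w - x)
      refine ⟨x + u, ?_, ?_⟩
      · rw [Real.dist_eq, add_sub_cancel_left, hu', ← dist_eq_norm]
        exact hw
      · rw [AddCircle.coe_add, hu]; abel
    · rintro ⟨t, ht, rfl⟩
      rw [dist_eq_norm, ← AddCircle.coe_sub]
      exact (norm_coe_le _).trans_lt ht
  have h2 : IsPreconnected (Metric.ball x r) := (convex_ball x r).isPreconnected
  change IsPreconnected (Metric.ball (x : UnitAddCircle) r)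
  rw [h]
  exact h2.image _ (AddCircle.continuous_mk' 1).continuousOn

theorem coe_rep (z : UnitAddCircle) : (rep z : UnitAddCircle) = z := AddCircle.coe_equivIco

theorem rep_nonneg (z : UnitAddCircle) : 0 ≤ rep z := (AddCircle.equivIco 1 0 z).2.1

theorem rep_lt_one (z : UnitAddCircle) : rep z < 1 :=
  (AddCircle.equivIco (1 : ℝ) 0 z).2.2.trans_eq (zero_add 1)

theorem Sfun_rep (z : UnitAddCircle) : Sfun (rep z) = 4 * ‖z‖ - 1 := by
  unfold Sfun
  split_ifs with h
  · rw [← UnitAddCircle.norm_coe_of_mem_Icc (rep_nonneg z) h, coe_rep]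
  · have := UnitAddCircle.norm_coe_of_half_le (le_of_not_ge h) (rep_lt_one z).le
    rw [coe_rep] at this
    rw [this]; ring

theorem plpdm_eq (a : UnitAddCircle) (b : ℝ) (z : UnitAddCircle) :
    plpdm a b z = z + z + ((2 * b * ‖z‖ - b / 2 : ℝ) : UnitAddCircle) + a := by
  have h : 2 * rep z + b / 2 * Sfun (rep z) = rep z + rep z + (2 * b * ‖z‖ - b / 2) := by
    rw [Sfun_rep]; ring
  rw [plpdm, h, AddCircle.coe_add, AddCircle.coe_add, coe_rep]

theorem continuous_plpdm :
    Continuous fun q : (UnitAddCircle × ℝ) × UnitAddCircle => plpdm q.1.1 q.1.2 q.2 := by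
  simp only [plpdm_eq]
  have h : Continuous fun q : (UnitAddCircle × ℝ) × UnitAddCircle =>
      ((2 * q.1.2 * ‖q.2‖ - q.1.2 / 2 : ℝ) : UnitAddCircle) :=
    (AddCircle.continuous_mk' (1 : ℝ)).comp (by fun_prop)
  fun_prop

theorem continuous_plpdm_iterate (n : ℕ) :
    Continuous fun q : (UnitAddCircle × ℝ) × UnitAddCircle => (plpdm q.1.1 q.1.2)^[n] q.2 := by
  induction n with
  | zero => simpa using continuous_snd
  | succ n ih =>
    simp only [Function.iterate_succ_apply']
    exact continuous_plpdm.comp (continuous_fst.prodMk ih)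

/-- The sign of the slope of the norm at a point of the circle, taken on the rising side at
`0` and at `1/2`. -/
noncomputable def slopeSign (z : UnitAddCircle) : ℝ := if rep z ≤ 1 / 2 then 1 else -1

theorem abs_slopeSign_le (z : UnitAddCircle) : |slopeSign z| ≤ 1 := by
  unfold slopeSign; split_ifs <;> simp

theorem exists_norm_add_eq {z : UnitAddCircle} (hz : z ≠ ((1 / 2 : ℝ) : UnitAddCircle)) :
    ∃ δ > 0, ∀ s ∈ Icc (0 : ℝ) δ, ‖z + (s : UnitAddCircle)‖ = ‖z‖ + slopeSign z * s := by
  have h0 := rep_nonneg z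
  have h1 := rep_lt_one z
  have hne : rep z ≠ 1 / 2 := fun h => hz (by rw [← h, coe_rep])
  unfold slopeSign
  split_ifs with h
  · refine ⟨1 / 2 - rep z, by linarith [lt_of_le_of_ne h hne], fun s hs => ?_⟩
    have e1 := UnitAddCircle.norm_coe_of_mem_Icc h0 h
    have e2 := UnitAddCircle.norm_coe_of_mem_Icc (x := rep z + s) (by linarith [hs.1])
      (by linarith [hs.2])
    rw [AddCircle.coe_add, coe_rep] at e2
    rw [coe_rep] at e1
    rw [e1, e2]; ring
  · refine ⟨1 - rep z, by linarith, fun s hs => ?_⟩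
    have e1 := UnitAddCircle.norm_coe_of_half_le (le_of_not_ge h) h1.le
    have e2 := UnitAddCircle.norm_coe_of_half_le (x := rep z + s) (by linarith [hs.1])
      (by linarith [hs.2])
    rw [AddCircle.coe_add, coe_rep] at e2
    rw [coe_rep] at e1
    rw [e1, e2]; ring

theorem exists_norm_sub_eq {z : UnitAddCircle} (hz : z ≠ 0) :
    ∃ δ > 0, ∀ s ∈ Icc (0 : ℝ) δ, ‖z - (s : UnitAddCircle)‖ = ‖z‖ - slopeSign z * s := by
  have h0 := rep_nonneg z
  have h1 := rep_lt_one z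
  have hne : rep z ≠ 0 := fun h => hz (by rw [← coe_rep z, h, AddCircle.coe_zero])
  unfold slopeSign
  split_ifs with h
  · refine ⟨rep z, lt_of_le_of_ne h0 hne.symm, fun s hs => ?_⟩
    have e1 := UnitAddCircle.norm_coe_of_mem_Icc h0 h
    have e2 := UnitAddCircle.norm_coe_of_mem_Icc (x := rep z - s) (by linarith [hs.2])
      (by linarith [hs.1])
    rw [AddCircle.coe_sub, coe_rep] at e2
    rw [coe_rep] at e1
    rw [e1, e2]; ring
  · refine ⟨rep z - 1 / 2, by linarith, fun s hs => ?_⟩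
    have e1 := UnitAddCircle.norm_coe_of_half_le (le_of_not_ge h) h1.le
    have e2 := UnitAddCircle.norm_coe_of_half_le (x := rep z - s) (by linarith [hs.2])
      (by linarith [hs.1])
    rw [AddCircle.coe_sub, coe_rep] at e2
    rw [coe_rep] at e1
    rw [e1, e2]; ring

theorem plpdm_sub_plpdm (a : UnitAddCircle) (b u : ℝ) {z w : UnitAddCircle}
    (hu : (u : UnitAddCircle) = z - w) :
    plpdm a b z - plpdm a b w = ((2 * u + 2 * b * (‖z‖ - ‖w‖) : ℝ) : UnitAddCircle) := by
  have h : 2 * u + 2 * b * (‖z‖ - ‖w‖) =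
      u + u + ((2 * b * ‖z‖ - b / 2) - (2 * b * ‖w‖ - b / 2)) := by ring
  rw [plpdm_eq, plpdm_eq, h]
  generalize 2 * b * ‖z‖ - b / 2 = A
  generalize 2 * b * ‖w‖ - b / 2 = B
  rw [AddCircle.coe_add, AddCircle.coe_add, AddCircle.coe_sub, hu]
  abel

theorem exists_dist_plpdm_le (z₀ : UnitAddCircle) :
    ∃ r > 0, ∀ (a : UnitAddCircle), ∀ b ∈ Icc (0 : ℝ) 1, ∀ z ∈ Metric.ball z₀ r,
      ∀ w ∈ Metric.ball z₀ r,
        dist (plpdm a b z) (plpdm a b w) ≤ (2 + 2 * b * slopeSign z₀) * dist z w := by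
  unfold slopeSign
  split_ifs with h
  · refine ⟨1, one_pos, fun a b hb z _ w _ => ?_⟩
    obtain ⟨u, hu, hu'⟩ := UnitAddCircle.exists_abs_eq_norm (z - w)
    rw [dist_eq_norm, plpdm_sub_plpdm a b u hu, dist_eq_norm z w, ← hu']
    refine (UnitAddCircle.norm_coe_le _).trans ((abs_add_le _ _).trans ?_)
    have h1 : |‖z‖ - ‖w‖| ≤ |u| := by rw [hu']; exact abs_norm_sub_norm_le z w
    rw [abs_mul, abs_mul, abs_two, abs_of_nonneg (by linarith [hb.1] : 0 ≤ 2 * b)]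
    nlinarith [hb.1]
  · have h1 := rep_lt_one z₀
    set t := rep z₀ with ht
    refine ⟨min (t - 1 / 2) (1 - t), lt_min (by linarith) (by linarith),
      fun a b hb z hz w hw => ?_⟩
    have key : ∀ z ∈ Metric.ball z₀ (min (t - 1 / 2) (1 - t)),
        ∃ u : ℝ, ((t + u : ℝ) : UnitAddCircle) = z ∧ |u| < t - 1 / 2 ∧ |u| < 1 - t ∧
          ‖z‖ = 1 - (t + u) := by
      intro z hz
      obtain ⟨u, hu, hu'⟩ := UnitAddCircle.exists_abs_eq_norm (z - z₀)
      rw [Metric.mem_ball, dist_eq_norm, ← hu', lt_min_iff] at hz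
      have e : ((t + u : ℝ) : UnitAddCircle) = z := by
        rw [AddCircle.coe_add, hu, ht, coe_rep]; abel
      refine ⟨u, e, hz.1, hz.2, ?_⟩
      rw [← e]
      exact UnitAddCircle.norm_coe_of_half_le (by linarith [(abs_lt.1 hz.1).1])
        (by linarith [(abs_lt.1 hz.2).2])
    obtain ⟨u, hu, hu1, hu2, hu3⟩ := key z hz
    obtain ⟨v, hv, hv1, hv2, hv3⟩ := key w hw
    have huv : ((u - v : ℝ) : UnitAddCircle) = z - w := by
      rw [← hu, ← hv, ← AddCircle.coe_sub]; congr 1; ring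
    have hn : ‖z - w‖ = |u - v| := by
      rw [← huv]
      apply UnitAddCircle.norm_coe_eq_abs
      rw [abs_lt] at *
      rw [abs_le]
      constructor <;> linarith
    rw [dist_eq_norm, plpdm_sub_plpdm a b _ huv, dist_eq_norm z w, hn, hu3, hv3]
    refine (UnitAddCircle.norm_coe_le _).trans (le_of_eq ?_)
    rw [show 2 * (u - v) + 2 * b * (1 - (t + u) - (1 - (t + v))) = (2 + 2 * b * -1) * (u - v) by
      ring, abs_mul, abs_of_nonneg (by linarith [hb.2] : 0 ≤ 2 + 2 * b * -1)]

theorem slope_nonneg {b : ℝ} (hb : b ∈ Icc (0 : ℝ) 1) (z : UnitAddCircle) :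
    0 ≤ 2 + 2 * b * slopeSign z := by
  have := abs_le.1 (abs_slopeSign_le z)
  nlinarith [hb.1, hb.2]

/-- Persistence of an attracting fixed point under perturbation of a local contraction. -/
theorem exists_continuousOn_fixedPoint {Q X : Type*} [TopologicalSpace Q] [MetricSpace X]
    [CompleteSpace X] {g : Q → X → X} (hg : Continuous fun q : Q × X => g q.1 q.2) {S W : Set Q}
    (hW : IsOpen W) {q₀ : Q} (hq₀ : q₀ ∈ W) {x₀ : X} (hx₀ : g q₀ x₀ = x₀)
    {c r : ℝ} (hc₀ : 0 ≤ c) (hc : c < 1) (hr : 0 < r)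
    (hlip : ∀ q ∈ W ∩ S, ∀ z ∈ Metric.closedBall x₀ r, ∀ w ∈ Metric.closedBall x₀ r,
      dist (g q z) (g q w) ≤ c * dist z w) (hS : q₀ ∈ S) :
    ∃ U : Set Q, IsOpen U ∧ q₀ ∈ U ∧ ∃ x : Q → X, ContinuousOn x (U ∩ S) ∧ x q₀ = x₀ ∧
      ∀ q ∈ U ∩ S, x q ∈ Metric.ball x₀ r ∧ g q (x q) = x q ∧
        MapsTo (g q) (Metric.ball x₀ r) (Metric.ball x₀ r) ∧
        ∀ y ∈ Metric.ball x₀ r, Tendsto (fun k => (g q)^[k] y) atTop (𝓝 (x q)) := by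
  have hgq : ∀ y, Continuous fun q => g q y := fun y =>
    hg.comp (continuous_id.prodMk continuous_const)
  set U : Set Q := W ∩ {q | dist (g q x₀) x₀ < (1 - c) * r} with hU
  have hUo : IsOpen U :=
    hW.inter (isOpen_lt ((hgq x₀).dist continuous_const) continuous_const)
  have hmaps : ∀ q ∈ U ∩ S, ∀ z ∈ Metric.closedBall x₀ r, g q z ∈ Metric.ball x₀ r := by
    rintro q ⟨⟨hqW, hq⟩, hqS⟩ z hz
    have h1 := hlip q ⟨hqW, hqS⟩ z hz x₀ (Metric.mem_closedBall_self hr.le)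
    have h2 := dist_triangle (g q z) (g q x₀) x₀
    have h3 : c * dist z x₀ ≤ c * r := mul_le_mul_of_nonneg_left hz hc₀
    have h4 : dist (g q x₀) x₀ < (1 - c) * r := hq
    rw [Metric.mem_ball]
    linarith
  have hfix : ∀ q ∈ U ∩ S, ∃ x ∈ Metric.ball x₀ r, g q x = x := by
    intro q hq
    have hm : MapsTo (g q) (Metric.closedBall x₀ r) (Metric.closedBall x₀ r) := fun z hz =>
      Metric.ball_subset_closedBall (hmaps q hq z hz)
    have hcon : ContractingWith ⟨c, hc₀⟩ (hm.restrict (g q) _ _) := by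
      refine ⟨by exact_mod_cast hc, LipschitzWith.of_dist_le_mul fun z w => ?_⟩
      exact hlip q ⟨hq.1.1, hq.2⟩ z z.2 w w.2
    obtain ⟨y, hy, hyf, -⟩ := hcon.exists_fixedPoint' (Metric.isClosed_closedBall.isComplete) hm
      (Metric.mem_closedBall_self hr.le) (edist_ne_top _ _)
    exact ⟨y, by simpa only [hyf.eq] using hmaps q hq y hy, hyf⟩
  have : Nonempty X := ⟨x₀⟩
  choose! x hxmem hxfix using hfix
  have hqU : q₀ ∈ U ∩ S := by
    refine ⟨⟨hq₀, ?_⟩, hS⟩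
    change dist (g q₀ x₀) x₀ < (1 - c) * r
    rw [hx₀, dist_self]
    exact mul_pos (by linarith) hr
  have hdist : ∀ q ∈ U ∩ S, ∀ y ∈ Metric.ball x₀ r,
      dist (g q y) (x q) ≤ c * dist y (x q) := by
    intro q hq y hy
    have := hlip q ⟨hq.1.1, hq.2⟩ y (Metric.ball_subset_closedBall hy) (x q)
      (Metric.ball_subset_closedBall (hxmem q hq))
    rwa [hxfix q hq] at this
  refine ⟨U, hUo, hqU.1, x, ?_, ?_, fun q hq => ⟨hxmem q hq, hxfix q hq, ?_, ?_⟩⟩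
  · intro q hq
    have hle : ∀ q' ∈ U ∩ S, dist (x q') (x q) ≤ dist (g q' (x q)) (x q) / (1 - c) := by
      intro q' hq'
      have h1 := hdist q' hq' (x q) (hxmem q hq)
      have h2 := dist_triangle (x q') (g q' (x q)) (x q)
      rw [dist_comm (x q') (g q' (x q))] at h2
      rw [dist_comm (x q) (x q')] at h1
      rw [le_div_iff₀ (by linarith)]
      linarith
    have hlim : Tendsto (fun q' => dist (g q' (x q)) (x q) / (1 - c)) (𝓝[U ∩ S] q) (𝓝 0) := by
      have h : Continuous fun q' => dist (g q' (x q)) (x q) / (1 - c) :=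
        ((hgq (x q)).dist continuous_const).div_const _
      have h2 := h.continuousWithinAt (s := U ∩ S) (x := q)
      unfold ContinuousWithinAt at h2
      simpa [hxfix q hq] using h2
    rw [ContinuousWithinAt, tendsto_iff_dist_tendsto_zero]
    refine tendsto_of_tendsto_of_tendsto_of_le_of_le' tendsto_const_nhds hlim
      (Eventually.of_forall fun _ => dist_nonneg) ?_
    filter_upwards [self_mem_nhdsWithin] with q' hq' using hle q' hq'
  · have h := hdist q₀ hqU x₀ (Metric.mem_ball_self hr)
    rw [hx₀] at h
    have h0 : dist x₀ (x q₀) = 0 := by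
      nlinarith [dist_nonneg (x := x₀) (y := x q₀)]
    exact (dist_eq_zero.1 h0).symm
  · exact fun z hz => hmaps q hq z (Metric.ball_subset_closedBall hz)
  · intro y hy
    have hk : ∀ k, (g q)^[k] y ∈ Metric.ball x₀ r ∧
        dist ((g q)^[k] y) (x q) ≤ c ^ k * dist y (x q) := by
      intro k
      induction k with
      | zero => simpa using hy
      | succ k ih =>
        rw [Function.iterate_succ_apply']
        refine ⟨hmaps q hq _ (Metric.ball_subset_closedBall ih.1),
          (hdist q hq _ ih.1).trans ?_⟩
        rw [pow_succ', mul_assoc]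
        exact mul_le_mul_of_nonneg_left ih.2 hc₀
    rw [tendsto_iff_dist_tendsto_zero]
    refine squeeze_zero (fun _ => dist_nonneg) (fun k => (hk k).2) ?_
    simpa using (tendsto_pow_atTop_nhds_zero_of_lt_one hc₀ hc).mul_const (dist y (x q))

/-- A monotone lift of a circle map of degree at least two moves the points to the right of a
fixed point to the left, as long as they are attracted to it. -/
theorem lt_self_of_tendsto {G : ℝ → ℝ} {g : UnitAddCircle → UnitAddCircle} {D x₀ : ℝ}
    (hGc : Continuous G) (hGm : Monotone G) (hD : 2 ≤ D) (hG1 : ∀ x, G (x + 1) = G x + D)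
    (hG0 : G x₀ = x₀) (hg : ∀ x : ℝ, ((G x : ℝ) : UnitAddCircle) = g x) {V : Set ℝ}
    (hV : V.OrdConnected) (hxV : x₀ ∈ V) (hGV : MapsTo G V V)
    (hlim : ∀ y ∈ V, Tendsto (fun k => g^[k] (y : UnitAddCircle)) atTop (𝓝 (x₀ : UnitAddCircle)))
    {y : ℝ} (hy : y ∈ V) (hxy : x₀ < y) : G y < y := by
  have hit : ∀ (k : ℕ) (z : ℝ), ((G^[k] z : ℝ) : UnitAddCircle) = g^[k] z := fun k z =>
    (Function.Semiconj.iterate_right (f := fun t : ℝ => (t : UnitAddCircle)) hg k) z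
  have hG01 : G (x₀ + 1) = x₀ + D := by rw [hG1, hG0]
  have hV1 : x₀ + 1 ∉ V := by
    intro h1
    have hsub : Icc x₀ (x₀ + 1) ⊆ V := hV.out hxV h1
    have hlo : G (G x₀) - x₀ = 0 := by rw [hG0, hG0, sub_self]
    have hhi : x₀ + D + (D - 1) ≤ G (G (x₀ + 1)) := by
      rw [hG01]
      have h2 : G (x₀ + 1 + 1) ≤ G (x₀ + D) := hGm (by linarith)
      rw [hG1, hG01] at h2
      linarith
    obtain ⟨z, hz, hz1⟩ := intermediate_value_Icc (by linarith : x₀ ≤ x₀ + 1)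
      (f := fun z => G (G z) - z) (by fun_prop) (show (1 : ℝ) ∈ Icc _ _ from
        ⟨by simp only [hlo]; exact zero_le_one, by linarith⟩)
    have hfix : (g^[2]) (z : UnitAddCircle) = z := by
      rw [← hit 2 z]
      have : G^[2] z = z + 1 := by
        change G (G z) = z + 1
        linarith
      rw [this]
      exact AddCircle.coe_add_period (1 : ℝ) z
    have hconst : ∀ k : ℕ, g^[2 * k] (z : UnitAddCircle) = z := by
      intro k
      rw [Function.iterate_mul]
      exact Function.iterate_fixed hfix k
    have hl := (hlim z (hsub hz)).comp
      (tendsto_id.const_mul_atTop' (two_pos : 0 < 2))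
    have hzx : (z : UnitAddCircle) = x₀ := by
      refine tendsto_nhds_unique ?_ hl
      simp only [Function.comp_def, id, hconst]
      exact tendsto_const_nhds
    obtain ⟨n, hn⟩ := UnitAddCircle.coe_eq_coe_iff.1 hzx
    have hn0 : (0 : ℝ) ≤ n := by rw [← hn]; linarith [hz.1]
    have hn1 : (n : ℝ) ≤ 1 := by rw [← hn]; linarith [hz.2]
    have hn0' : 0 ≤ n := by exact_mod_cast hn0
    have hn1' : n ≤ 1 := by exact_mod_cast hn1
    obtain rfl | rfl : n = 0 ∨ n = 1 := by omega
    · have : z = x₀ := by push_cast at hn; linarith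
      subst this
      simp only at hz1
      linarith
    · have : z = x₀ + 1 := by push_cast at hn; linarith
      subst this
      simp only at hz1
      linarith
  by_contra! hle
  have hmono := hGm.monotone_iterate_of_le_map hle
  have hmem : ∀ k, G^[k] y ∈ V := fun k => hGV.iterate k hy
  have hbd : ∀ k, G^[k] y ≤ x₀ + 1 := by
    intro k
    by_contra! h
    exact hV1 (hV.out hxV (hmem k) ⟨by linarith, h.le⟩)
  have hconv := tendsto_atTop_ciSup hmono ⟨x₀ + 1, by rintro _ ⟨k, rfl⟩; exact hbd k⟩
  set l := ⨆ k, G^[k] y with hl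
  have hfix : G l = l := isFixedPt_of_tendsto_iterate hconv hGc.continuousAt
  have hyl : y ≤ l := ge_of_tendsto' hconv fun k => hmono (Nat.zero_le k)
  have hl1 : l ≤ x₀ + 1 := le_of_tendsto' hconv hbd
  have hlx : (l : UnitAddCircle) = x₀ := by
    refine tendsto_nhds_unique ?_ (hlim y hy)
    simp only [← hit]
    exact ((AddCircle.continuous_mk' (1 : ℝ)).tendsto l).comp hconv
  obtain ⟨n, hn⟩ := UnitAddCircle.coe_eq_coe_iff.1 hlx
  have hn0 : (0 : ℝ) < n := by rw [← hn]; linarith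
  have hn1 : (n : ℝ) ≤ 1 := by rw [← hn]; linarith
  have hn0' : 0 < n := by exact_mod_cast hn0
  have hn1' : n ≤ 1 := by exact_mod_cast hn1
  obtain rfl : n = 1 := by omega
  have : l = x₀ + 1 := by push_cast at hn; linarith
  rw [this, hG01] at hfix
  linarith

/-- The mirror image of `lt_self_of_tendsto`. -/
theorem self_lt_of_tendsto {G : ℝ → ℝ} {g : UnitAddCircle → UnitAddCircle} {D x₀ : ℝ}
    (hGc : Continuous G) (hGm : Monotone G) (hD : 2 ≤ D) (hG1 : ∀ x, G (x + 1) = G x + D)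
    (hG0 : G x₀ = x₀) (hg : ∀ x : ℝ, ((G x : ℝ) : UnitAddCircle) = g x) {V : Set ℝ}
    (hV : V.OrdConnected) (hxV : x₀ ∈ V) (hGV : MapsTo G V V)
    (hlim : ∀ y ∈ V, Tendsto (fun k => g^[k] (y : UnitAddCircle)) atTop (𝓝 (x₀ : UnitAddCircle)))
    {y : ℝ} (hy : y ∈ V) (hxy : y < x₀) : y < G y := by
  have hconj : ∀ (k : ℕ) (z : UnitAddCircle), (fun w => -g (-w))^[k] z = -g^[k] (-z) := by
    intro k
    induction k with
    | zero => simp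
    | succ k ih => intro z; rw [Function.iterate_succ_apply', ih, Function.iterate_succ_apply',
        neg_neg]
  have h := lt_self_of_tendsto (G := fun x => -G (-x)) (g := fun w => -g (-w)) (D := D)
    (x₀ := -x₀) (V := {x | -x ∈ V}) (y := -y) (by fun_prop)
    (fun a b hab => neg_le_neg (hGm (neg_le_neg hab))) hD
    (fun x => by
      have := hG1 (-(x + 1))
      rw [show -(x + 1) + 1 = -x by ring] at this
      simp only [this]; ring)
    (by simp [hG0]) (fun x => by simp [hg])
    ⟨fun a ha b hb x hx => hV.out hb ha ⟨neg_le_neg hx.2, neg_le_neg hx.1⟩⟩ (by simpa using hxV)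
    (fun x hx => by simpa using hGV hx)
    (fun z hz => by
      simp only [hconj, AddCircle.coe_neg]
      simpa using (hlim (-z) hz).neg)
    (by simpa using hy) (by linarith)
  simp only [neg_neg] at h
  linarith

/-- A lift to the real line of a piecewise linear perturbation of the doubling map. -/
noncomputable def plpdmLift (b c x : ℝ) : ℝ := 2 * x + 2 * b * ‖(x : UnitAddCircle)‖ + c

theorem continuous_plpdmLift (b c : ℝ) : Continuous (plpdmLift b c) := by
  have h : Continuous fun x : ℝ => ‖(x : UnitAddCircle)‖ :=
    continuous_norm.comp (AddCircle.continuous_mk' (1 : ℝ))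
  unfold plpdmLift
  fun_prop

theorem coe_plpdmLift {a : UnitAddCircle} {b c : ℝ}
    (hc : (c : UnitAddCircle) = a - ((b / 2 : ℝ) : UnitAddCircle)) (x : ℝ) :
    (plpdmLift b c x : UnitAddCircle) = plpdm a b x := by
  have h : plpdmLift b c x = x + x + 2 * b * ‖(x : UnitAddCircle)‖ + c := by
    unfold plpdmLift; ring
  rw [h, plpdm_eq]
  generalize 2 * b * ‖(x : UnitAddCircle)‖ = A
  generalize b / 2 = B at *
  rw [AddCircle.coe_add, AddCircle.coe_add, AddCircle.coe_add, AddCircle.coe_sub, hc]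
  abel

theorem plpdmLift_add_int (b c x : ℝ) (n : ℤ) :
    plpdmLift b c (x + n) = plpdmLift b c x + 2 * n := by
  have h : ((x + n : ℝ) : UnitAddCircle) = x := UnitAddCircle.coe_eq_coe_iff.2 ⟨n, by ring⟩
  unfold plpdmLift
  rw [h]; ring

theorem plpdmLift_iterate_add_int (b c : ℝ) (k : ℕ) (x : ℝ) (n : ℤ) :
    (plpdmLift b c)^[k] (x + n) = (plpdmLift b c)^[k] x + 2 ^ k * n := by
  induction k with
  | zero => simp
  | succ k ih =>
    rw [Function.iterate_succ_apply', ih, Function.iterate_succ_apply']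
    have := plpdmLift_add_int b c ((plpdmLift b c)^[k] x) (2 ^ k * n)
    push_cast at this
    rw [this]; ring

theorem le_plpdmLift_sub {b c x y : ℝ} (hb : 0 ≤ b) (hxy : x ≤ y) :
    (2 - 2 * b) * (y - x) ≤ plpdmLift b c y - plpdmLift b c x := by
  have h1 : |‖(x : UnitAddCircle)‖ - ‖(y : UnitAddCircle)‖| ≤ y - x := by
    refine (abs_norm_sub_norm_le _ _).trans ?_
    rw [← AddCircle.coe_sub]
    refine (UnitAddCircle.norm_coe_le _).trans ?_
    rw [abs_of_nonpos (by linarith)]; linarith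
  have h2 := (abs_le.1 h1).2
  unfold plpdmLift
  nlinarith

theorem monotone_plpdmLift {b : ℝ} (hb : b ∈ Icc (0 : ℝ) 1) (c : ℝ) :
    Monotone (plpdmLift b c) := by
  intro x y hxy
  have := le_plpdmLift_sub (c := c) hb.1 hxy
  nlinarith [hb.2]

theorem strictMono_plpdmLift {b : ℝ} (hb : b ∈ Ico (0 : ℝ) 1) (c : ℝ) :
    StrictMono (plpdmLift b c) := by
  intro x y hxy
  have := le_plpdmLift_sub (c := c) hb.1 hxy.le
  have : 0 < (2 - 2 * b) * (y - x) := mul_pos (by linarith [hb.2]) (by linarith)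
  linarith

theorem plpdmLift_iterate_one_sided {b c : ℝ} (hb : b ∈ Icc (0 : ℝ) 1) {x e : ℝ}
    (h : ∀ i : ℕ, ∃ δ > 0, ∀ s ∈ Icc (0 : ℝ) δ,
      ‖(((plpdmLift b c)^[i] x + e * s : ℝ) : UnitAddCircle)‖ =
        ‖((plpdmLift b c)^[i] x : UnitAddCircle)‖ +
          slopeSign ((plpdmLift b c)^[i] x : UnitAddCircle) * (e * s)) (k : ℕ) :
    ∃ δ > 0, ∀ s ∈ Icc (0 : ℝ) δ, (plpdmLift b c)^[k] (x + e * s) = (plpdmLift b c)^[k] x +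
      (∏ i ∈ Finset.range k,
        (2 + 2 * b * slopeSign ((plpdmLift b c)^[i] x : UnitAddCircle))) * (e * s) := by
  induction k with
  | zero => exact ⟨1, one_pos, by simp⟩
  | succ k ih =>
    obtain ⟨δ, hδ, hk⟩ := ih
    obtain ⟨η, hη, hN⟩ := h k
    have hM : 0 ≤ ∏ i ∈ Finset.range k,
        (2 + 2 * b * slopeSign ((plpdmLift b c)^[i] x : UnitAddCircle)) :=
      Finset.prod_nonneg fun i _ => slope_nonneg hb _
    rw [Finset.prod_range_succ]
    generalize ∏ i ∈ Finset.range k,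
        (2 + 2 * b * slopeSign ((plpdmLift b c)^[i] x : UnitAddCircle)) = M at *
    refine ⟨min δ (η / (M + 1)), lt_min hδ (by positivity), fun s hs => ?_⟩
    have hs1 : s ≤ δ := hs.2.trans (min_le_left _ _)
    have hs2 : s * (M + 1) ≤ η :=
      (le_div_iff₀ (by positivity)).1 (hs.2.trans (min_le_right _ _))
    have hs0 := hs.1
    rw [Function.iterate_succ_apply', hk s ⟨hs0, hs1⟩, Function.iterate_succ_apply']
    have hN' := hN (M * s) ⟨by positivity, by nlinarith⟩
    rw [show M * (e * s) = e * (M * s) by ring]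
    unfold plpdmLift at hN' ⊢
    rw [hN']; ring

theorem UnitAddCircle.norm_coe_affine_of_forall_ne {α β : ℝ}
    (h : ∀ y ∈ Ioo α β, (y : UnitAddCircle) ≠ 0 ∧
      (y : UnitAddCircle) ≠ ((1 / 2 : ℝ) : UnitAddCircle)) :
    ∃ σ τ : ℝ, ∀ x ∈ Icc α β, ‖(x : UnitAddCircle)‖ = σ * x + τ := by
  have h1 := Int.floor_le (2 * α)
  have h2 := Int.lt_floor_add_one (2 * α)
  have shift : ∀ (x : ℝ) (m : ℤ), (x : UnitAddCircle) = ((x - m : ℝ) : UnitAddCircle) :=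
    fun x m => UnitAddCircle.coe_eq_coe_iff.2 ⟨m, by ring⟩
  obtain ⟨m, hm | hm⟩ := Int.even_or_odd' ⌊2 * α⌋
  · rw [hm] at h1 h2
    push_cast at h1 h2
    have hβ : β ≤ m + 1 / 2 := by
      by_contra! hβ
      refine (h (m + 1 / 2) ⟨by linarith, hβ⟩).2 ?_
      rw [shift _ m]; congr 1; ring
    refine ⟨1, -m, fun x hx => ?_⟩
    rw [shift x m, norm_coe_of_mem_Icc (by linarith [hx.1]) (by linarith [hx.2])]
    ring
  · rw [hm] at h1 h2
    push_cast at h1 h2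
    have hβ : β ≤ m + 1 := by
      by_contra! hβ
      refine (h (m + 1) ⟨by linarith, hβ⟩).1 ?_
      rw [shift _ (m + 1)]; simp
    refine ⟨-1, m + 1, fun x hx => ?_⟩
    rw [shift x m, norm_coe_of_half_le (by linarith [hx.1]) (by linarith [hx.2])]
    ring

theorem plpdmLift_iterate_affine {b c : ℝ} (hb : b ∈ Icc (0 : ℝ) 1) {x v : ℝ} (hxv : x ≤ v)
    (h : ∀ y ∈ Ioo x v, ∀ i : ℕ, ((plpdmLift b c)^[i] y : UnitAddCircle) ≠ 0 ∧
      ((plpdmLift b c)^[i] y : UnitAddCircle) ≠ ((1 / 2 : ℝ) : UnitAddCircle)) (k : ℕ) :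
    ∃ m τ : ℝ, ∀ y ∈ Icc x v, (plpdmLift b c)^[k] y = m * y + τ := by
  induction k with
  | zero => exact ⟨1, 0, by simp⟩
  | succ k ih =>
    obtain ⟨m, τ, hk⟩ := ih
    have hmono := (monotone_plpdmLift hb c).iterate k
    obtain ⟨σ, ρ, hN⟩ := UnitAddCircle.norm_coe_affine_of_forall_ne
      (α := (plpdmLift b c)^[k] x) (β := (plpdmLift b c)^[k] v) (by
        intro y hy
        obtain ⟨z, hz, rfl⟩ :=
          intermediate_value_Ioo hxv ((continuous_plpdmLift b c).iterate k).continuousOn hy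
        exact h z hz k)
    refine ⟨(2 + 2 * b * σ) * m, (2 + 2 * b * σ) * τ + 2 * b * ρ + c, fun y hy => ?_⟩
    have hy' := hN _ ⟨hmono hy.1, hmono hy.2⟩
    rw [Function.iterate_succ_apply', plpdmLift, hy', hk y hy]
    ring

theorem iterate_eq_self_of_mem_orbit {α : Type*} {f : α → α} {p : ℕ} {x : α} (h : f^[p] x = x)
    (j : ℕ) : f^[p] (f^[j] x) = f^[j] x := by
  rw [← Function.iterate_add_apply, add_comm, Function.iterate_add_apply, h]

/-- The slopes along an attracting cycle, taken on the rising side at the break points, have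
product less than one. -/
theorem prod_slope_lt_one {a : UnitAddCircle} {b : ℝ} (hb : b ∈ Icc (0 : ℝ) 1) {p : ℕ}
    {x₀ : UnitAddCircle} (hx : IsAttractingPeriodicPt (plpdm a b) p x₀) :
    ∏ i ∈ Finset.range p, (2 + 2 * b * slopeSign ((plpdm a b)^[i] x₀)) < 1 := by
  obtain ⟨hp, hper, -, U, hUo, -, hxU, hUU, hlim⟩ := hx
  obtain ⟨x, rfl⟩ := QuotientAddGroup.mk_surjective x₀
  change (plpdm a b)^[p] (x : UnitAddCircle) = (x : UnitAddCircle) at hper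
  obtain ⟨c, hc⟩ := QuotientAddGroup.mk_surjective (a - ((b / 2 : ℝ) : UnitAddCircle))
  change (c : UnitAddCircle) = _ at hc
  set F := plpdmLift b c with hF
  set f := plpdm a b with hf
  have hFf : ∀ (k : ℕ) (z : ℝ), ((F^[k] z : ℝ) : UnitAddCircle) = f^[k] z := fun k z =>
    (Function.Semiconj.iterate_right (f := fun t : ℝ => (t : UnitAddCircle))
      (coe_plpdmLift hc) k) z
  obtain ⟨n, hn⟩ := UnitAddCircle.coe_eq_coe_iff.1 ((hFf p x).trans hper)
  set G : ℝ → ℝ := fun z => F^[p] z - n with hG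
  have hGc : Continuous G := ((continuous_plpdmLift b c).iterate p).sub continuous_const
  have hGm : Monotone G := fun z w hzw => by
    have := (monotone_plpdmLift hb c).iterate p hzw
    simp only [hG]; linarith
  have hG0 : G x = x := by simp only [hG]; linarith
  have hD : (2 : ℝ) ≤ 2 ^ p := by
    simpa using pow_le_pow_right₀ (one_le_two (α := ℝ)) hp
  have hG1 : ∀ z, G (z + 1) = G z + 2 ^ p := by
    intro z
    have := plpdmLift_iterate_add_int b c p z 1
    simp only [Int.cast_one, mul_one] at this
    simp only [hG, hF, this]; ring
  have hg : ∀ z : ℝ, ((G z : ℝ) : UnitAddCircle) = f^[p] z := by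
    intro z
    rw [← hFf]
    exact UnitAddCircle.coe_eq_coe_iff.2 ⟨-n, by simp [hG]⟩
  set P : Set ℝ := (fun t : ℝ => (t : UnitAddCircle)) ⁻¹' U with hP
  have hPo : IsOpen P := hUo.preimage (AddCircle.continuous_mk' (1 : ℝ))
  set V := connectedComponentIn P x with hV
  have hxV : x ∈ V := mem_connectedComponentIn hxU
  have hVo : IsOpen V := hPo.connectedComponentIn
  have hVP : V ⊆ P := connectedComponentIn_subset P x
  have hVc : V.OrdConnected := isPreconnected_connectedComponentIn.ordConnected
  have hGV : MapsTo G V V := by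
    rw [mapsTo_iff_image_subset]
    refine (isPreconnected_connectedComponentIn.image G
      hGc.continuousOn).subset_connectedComponentIn ⟨x, hxV, hG0⟩ ?_
    rintro _ ⟨z, hz, rfl⟩
    change ((G z : ℝ) : UnitAddCircle) ∈ U
    rw [hg]
    exact hUU ⟨_, hVP hz, rfl⟩
  have hlimV : ∀ y ∈ V, Tendsto (fun k => (f^[p])^[k] (y : UnitAddCircle)) atTop
      (𝓝 (x : UnitAddCircle)) := by
    intro y hy
    simp only [← Function.iterate_mul]
    exact hlim _ (hVP hy)
  have hright : ∀ y ∈ V, x < y → G y < y := fun y hy hxy =>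
    lt_self_of_tendsto hGc hGm hD hG1 hG0 hg hVc hxV hGV hlimV hy hxy
  have hleft : ∀ y ∈ V, y < x → y < G y := fun y hy hxy =>
    self_lt_of_tendsto hGc hGm hD hG1 hG0 hg hVc hxV hGV hlimV hy hxy
  obtain ⟨ε, hε, hεV⟩ := Metric.isOpen_iff.1 hVo x hxV
  by_cases hhalf : ∃ i, f^[i] (x : UnitAddCircle) = ((1 / 2 : ℝ) : UnitAddCircle)
  swap
  · push Not at hhalf
    obtain ⟨δ, hδ, hexp⟩ := plpdmLift_iterate_one_sided (c := c) hb (x := x) (e := 1) (fun i => by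
      obtain ⟨δ, hδ, h⟩ := exists_norm_add_eq (hhalf i)
      refine ⟨δ, hδ, fun s hs => ?_⟩
      rw [one_mul, AddCircle.coe_add, ← hF, hFf, h s hs]) p
    simp only [← hF, hFf] at hexp
    generalize ∏ i ∈ Finset.range p, (2 + 2 * b * slopeSign (f^[i] (x : UnitAddCircle))) = M at *
    set s := min δ (ε / 2) with hs
    have hs0 : 0 < s := lt_min hδ (by linarith)
    have h1 := hexp s ⟨hs0.le, min_le_left _ _⟩
    have h2 := hright (x + 1 * s) (hεV (by
      rw [Metric.mem_ball, Real.dist_eq, add_sub_cancel_left, one_mul, abs_of_pos hs0]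
      linarith [min_le_right δ (ε / 2)])) (by linarith)
    simp only [hG] at h2
    rw [h1] at h2
    nlinarith
  by_cases hzero : ∃ j, f^[j] (x : UnitAddCircle) = 0
  swap
  · push Not at hzero
    obtain ⟨δ, hδ, hexp⟩ := plpdmLift_iterate_one_sided (c := c) hb (x := x) (e := -1) (fun i => by
      obtain ⟨δ, hδ, h⟩ := exists_norm_sub_eq (hzero i)
      refine ⟨δ, hδ, fun s hs => ?_⟩
      rw [neg_one_mul, ← sub_eq_add_neg, AddCircle.coe_sub, ← hF, hFf, h s hs]
      ring) p
    simp only [← hF, hFf] at hexp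
    generalize ∏ i ∈ Finset.range p, (2 + 2 * b * slopeSign (f^[i] (x : UnitAddCircle))) = M at *
    set s := min δ (ε / 2) with hs
    have hs0 : 0 < s := lt_min hδ (by linarith)
    have h1 := hexp s ⟨hs0.le, min_le_left _ _⟩
    have h2 := hleft (x + -1 * s) (hεV (by
      rw [Metric.mem_ball, Real.dist_eq, add_sub_cancel_left, neg_one_mul, abs_neg,
        abs_of_pos hs0]
      linarith [min_le_right δ (ε / 2)])) (by linarith)
    simp only [hG] at h2
    rw [h1] at h2
    nlinarith
  exfalso
  obtain ⟨i₁, hi₁⟩ := hhalf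
  obtain ⟨i₀, hi₀⟩ := hzero
  obtain hb1 | hb1 := hb.2.eq_or_lt
  · have hper1 := iterate_eq_self_of_mem_orbit hper i₁
    have hper0 := iterate_eq_self_of_mem_orbit hper i₀
    rw [hi₁] at hper1
    rw [hi₀] at hper0
    have hff : f ((1 / 2 : ℝ) : UnitAddCircle) = f 0 := by
      have h2 := plpdm_sub_plpdm a b (1 / 2) (z := ((1 / 2 : ℝ) : UnitAddCircle)) (w := 0)
        (by simp)
      rw [UnitAddCircle.norm_coe_of_mem_Icc (by norm_num) le_rfl, norm_zero, hb1] at h2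
      rw [← sub_eq_zero, hf, hb1, h2]
      exact (AddCircle.coe_eq_zero_iff 1).2 ⟨2, by norm_num⟩
    have h01 : ((1 / 2 : ℝ) : UnitAddCircle) = 0 := by
      rw [← hper1, ← hper0, ← Nat.succ_pred_eq_of_pos hp, Function.iterate_succ_apply,
        Function.iterate_succ_apply, hff]
    have h02 := congrArg norm h01
    rw [UnitAddCircle.norm_coe_of_mem_Icc (by norm_num) le_rfl, norm_zero] at h02
    norm_num at h02
  · set y₁ := x + min (ε / 2) 1 with hy₁
    have hm0 : 0 < min (ε / 2) 1 := lt_min (by linarith) one_pos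
    have hm1 := min_le_left (ε / 2) 1
    have hm2 := min_le_right (ε / 2) 1
    have hinit : ∀ z, x < z → z ≤ y₁ → G z < z := fun z hz hz1 => hright z (hεV (by
      rw [Metric.mem_ball, Real.dist_eq, abs_of_pos (by linarith)]; linarith)) hz
    have hcpt : IsCompact (Icc y₁ (x + 1) ∩ {z | z ≤ G z}) :=
      isCompact_Icc.inter_right (isClosed_le continuous_id hGc)
    obtain ⟨v, ⟨⟨hv1, hv2⟩, hvG⟩, hvmin⟩ := hcpt.exists_isLeast
      ⟨x + 1, ⟨by linarith, le_rfl⟩, by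
        change x + 1 ≤ G (x + 1)
        rw [hG1, hG0]; linarith⟩
    change v ≤ G v at hvG
    have hxv : x < v := by linarith
    have hlt : ∀ z ∈ Ioo x v, G z < z := by
      intro z hz
      by_contra! hle
      have hz1 : y₁ < z := by
        by_contra! h
        exact absurd (hinit z hz.1 h) (not_lt.2 hle)
      exact absurd (hvmin ⟨⟨hz1.le, by linarith [hz.2]⟩, hle⟩) (not_le.2 hz.2)
    have hGs : StrictMono G := fun z w hzw => by
      have := (strictMono_plpdmLift ⟨hb.1, hb1⟩ c).iterate p hzw
      simp only [hG]; linarith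
    have havoid : ∀ y ∈ Ioo x v, ∀ i j : ℕ,
        ((F^[i] y : ℝ) : UnitAddCircle) ≠ f^[j] (x : UnitAddCircle) := by
      intro y hy i j hij
      rw [hFf] at hij
      have hw : ∀ k, G^[k] y ∈ Ioo x v := by
        intro k
        induction k with
        | zero => exact hy
        | succ k ih =>
          rw [Function.iterate_succ_apply']
          exact ⟨hG0.symm.trans_lt (hGs ih.1), (hlt _ ih).trans ih.2⟩
      have hwf : ((G^[i] y : ℝ) : UnitAddCircle) = f^[p * i] y := by
        rw [Function.iterate_mul]
        exact (Function.Semiconj.iterate_right (f := fun t : ℝ => (t : UnitAddCircle)) hg i) y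
      have hle : i ≤ p * i := Nat.le_mul_of_pos_left i hp
      have hfixed : f^[p] ((G^[i] y : ℝ) : UnitAddCircle) = ((G^[i] y : ℝ) : UnitAddCircle) := by
        rw [hwf, ← Nat.sub_add_cancel hle, Function.iterate_add_apply, hij,
          ← Function.iterate_add_apply f (p * i - i)]
        exact iterate_eq_self_of_mem_orbit hper _
      obtain ⟨N, hN⟩ := UnitAddCircle.coe_eq_coe_iff.1 ((hg _).trans hfixed)
      have h1 := hlt _ (hw i)
      have h2 := (hw i).2
      have h3 : x < G (G^[i] y) := hG0.symm.trans_lt (hGs (hw i).1)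
      have h4 : (N : ℝ) < 0 := by rw [← hN]; linarith
      have h5 : (-1 : ℝ) < N := by rw [← hN]; linarith
      have h4' : N < 0 := by exact_mod_cast h4
      have h5' : -1 < N := by exact_mod_cast h5
      omega
    obtain ⟨m, τ, hmτ⟩ := plpdmLift_iterate_affine (c := c) hb hxv.le
      (fun y hy i => ⟨hi₀ ▸ havoid y hy i i₀, hi₁ ▸ havoid y hy i i₁⟩) p
    have e1 := hmτ x ⟨le_rfl, hxv.le⟩
    have e2 := hmτ v ⟨hxv.le, le_rfl⟩
    have e3 := hmτ ((x + v) / 2) ⟨by linarith, by linarith⟩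
    have e4 := hlt ((x + v) / 2) ⟨by linarith, by linarith⟩
    simp only [hG, ← hF] at *
    linarith

theorem stmt9 (a₀ : UnitAddCircle) (b₀ : ℝ) (hb₀ : b₀ ∈ Set.Icc (0:ℝ) 1)
    (p : ℕ) (x₀ : UnitAddCircle)
    (hx₀ : IsAttractingPeriodicPt (plpdm a₀ b₀) p x₀) :
    ∃ U : Set (UnitAddCircle × ℝ), IsOpen U ∧ (a₀, b₀) ∈ U ∧
      ∃ X : UnitAddCircle × ℝ → UnitAddCircle,
        ContinuousOn X (U ∩ {q : UnitAddCircle × ℝ | q.2 ∈ Set.Icc (0:ℝ) 1}) ∧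
        X (a₀, b₀) = x₀ ∧
        ∀ q ∈ U ∩ {q : UnitAddCircle × ℝ | q.2 ∈ Set.Icc (0:ℝ) 1},
          IsAttractingPeriodicPt (plpdm q.1 q.2) p (X q) := by
  obtain ⟨hp, hper, hexact, -⟩ := id hx₀
  set f₀ := plpdm a₀ b₀ with hf₀
  set S : Set (UnitAddCircle × ℝ) := {q | q.2 ∈ Icc (0 : ℝ) 1} with hS
  set M : ℝ → ℝ := fun b => ∏ i ∈ Finset.range p, (2 + 2 * b * slopeSign (f₀^[i] x₀)) with hM
  have hM1 : M b₀ < 1 := prod_slope_lt_one hb₀ hx₀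
  have hM0 : 0 ≤ M b₀ := Finset.prod_nonneg fun i _ => slope_nonneg hb₀ _
  obtain ⟨c, hc0, hc1⟩ := exists_between hM1
  have hMc : Continuous M := by unfold M; fun_prop
  choose r hr hcontr using fun i : ℕ => exists_dist_plpdm_le (f₀^[i] x₀)
  have hev : ∀ᶠ q : (UnitAddCircle × ℝ) × UnitAddCircle in 𝓝 ((a₀, b₀), x₀),
      M q.1.2 < c ∧ ∀ i ∈ Finset.range p,
        (plpdm q.1.1 q.1.2)^[i] q.2 ∈ Metric.ball (f₀^[i] x₀) (r i) := by
    refine Filter.Eventually.and ?_ ?_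
    · exact (hMc.comp (continuous_snd.comp continuous_fst)).continuousAt.eventually_lt
        continuousAt_const hc0
    · rw [Filter.eventually_all_finset]
      exact fun i _ => (continuous_plpdm_iterate i).continuousAt.eventually
        (Metric.ball_mem_nhds _ (hr i))
  rw [nhds_prod_eq, Filter.eventually_prod_iff] at hev
  obtain ⟨P₁, hP₁, P₂, hP₂, hP⟩ := hev
  obtain ⟨W, hWP, hWo, hW⟩ := mem_nhds_iff.1 hP₁
  obtain ⟨ρ, hρ, hρP⟩ := Metric.nhds_basis_closedBall.mem_iff.1 hP₂
  have hlip : ∀ q ∈ W ∩ S, ∀ z ∈ Metric.closedBall x₀ ρ, ∀ w ∈ Metric.closedBall x₀ ρ,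
      dist ((plpdm q.1 q.2)^[p] z) ((plpdm q.1 q.2)^[p] w) ≤ c * dist z w := by
    intro q hq z hz w hw
    have hz' := hP (hWP hq.1) (hρP hz)
    have hw' := hP (hWP hq.1) (hρP hw)
    have hind : ∀ k ≤ p, dist ((plpdm q.1 q.2)^[k] z) ((plpdm q.1 q.2)^[k] w) ≤
        (∏ i ∈ Finset.range k, (2 + 2 * q.2 * slopeSign (f₀^[i] x₀))) * dist z w := by
      intro k hk
      induction k with
      | zero => simp
      | succ k ih =>
        rw [Function.iterate_succ_apply', Function.iterate_succ_apply', Finset.prod_range_succ]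
        refine (hcontr k q.1 q.2 hq.2 _ (hz'.2 k (Finset.mem_range.2 hk)) _
          (hw'.2 k (Finset.mem_range.2 hk))).trans ?_
        refine (mul_le_mul_of_nonneg_left (ih (Nat.le_of_succ_le hk))
          (slope_nonneg hq.2 _)).trans (le_of_eq (by ring))
    exact (hind p le_rfl).trans (mul_le_mul_of_nonneg_right hz'.1.le dist_nonneg)
  have hqS : (a₀, b₀) ∈ S := hb₀
  obtain ⟨U, hUo, hqU, X, hXc, hX0, hX⟩ := exists_continuousOn_fixedPoint
    (g := fun q : UnitAddCircle × ℝ => (plpdm q.1 q.2)^[p]) (continuous_plpdm_iterate p) hWo hW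
    hper (hM0.trans hc0.le) hc1 hρ hlip hqS
  have hne : ∀ᶠ q in 𝓝[U ∩ S] (a₀, b₀), ∀ m ∈ Finset.Ioo 0 p,
      (plpdm q.1 q.2)^[m] (X q) ≠ X q := by
    rw [Filter.eventually_all_finset]
    intro m hm
    rw [Finset.mem_Ioo] at hm
    have h1 : Tendsto X (𝓝[U ∩ S] (a₀, b₀)) (𝓝 x₀) := by
      simpa only [ContinuousWithinAt, hX0] using hXc _ ⟨hqU, hqS⟩
    have hpair : Tendsto (fun q => (q, X q)) (𝓝[U ∩ S] (a₀, b₀)) (𝓝 ((a₀, b₀), x₀)) :=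
      (tendsto_id.mono_left nhdsWithin_le_nhds).prodMk_nhds h1
    have hcont : Tendsto (fun q : (UnitAddCircle × ℝ) × UnitAddCircle =>
        (plpdm q.1.1 q.1.2)^[m] q.2) (𝓝 ((a₀, b₀), x₀)) (𝓝 (f₀^[m] x₀)) :=
      (continuous_plpdm_iterate m).continuousAt
    have h2 := hcont.comp hpair
    exact (h2.prodMk_nhds h1).eventually
      (isOpen_ne_fun continuous_fst continuous_snd |>.mem_nhds (hexact m hm.1 hm.2))
  obtain ⟨U', hU'o, hqU', hU'⟩ := mem_nhdsWithin.1 hne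
  refine ⟨U ∩ U', hUo.inter hU'o, ⟨hqU, hqU'⟩, X,
    hXc.mono fun q hq => ⟨hq.1.1, hq.2⟩, hX0, fun q hq => ?_⟩
  obtain ⟨hXb, hXf, hXm, hXl⟩ := hX q ⟨hq.1.1, hq.2⟩
  refine ⟨hp, hXf, fun m hm hmp => hU' ⟨hq.1.2, hq.1.1, hq.2⟩ m (Finset.mem_Ioo.2 ⟨hm, hmp⟩),
    Metric.ball x₀ ρ, Metric.isOpen_ball, ⟨⟨_, hXb⟩, UnitAddCircle.isPreconnected_ball _ _⟩, hXb,
    hXm.image_subset, fun y hy => ?_⟩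
  simp only [Function.iterate_mul]
  exact hXl y hy
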